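/- Generalized Łoś–Tarski theorem GLT(k), hereditary direction: let τ be a finite first-order vocabulary, V an FO(τ) theory, φ an FO(τ) sentence, and k a natural number. Then φ is k-hereditary modulo V if and only if φ is equivalent modulo V to an ∃^k∀* sentence, i.e., a prenex sentence of the form ∃x₁…∃x_k ∀y₁…∀y_n ψ for some n, with ψ quantifier-free. (All structures here are arbitrary, possibly infinite.) -/

import Mathlib

open FirstOrder Language

universe u v w

namespace GLTPaper

variable {L : FirstOrder.Language.{u, v}}

/-- Universally quantify over the last `n` free (de Bruijn) variables of a bounded formula,
leaving the first `k` variables free. -/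
def allsFrom (k : ℕ) : ∀ {n : ℕ}, L.BoundedFormula Empty (k + n) → L.BoundedFormula Empty k
  | 0, ψ => ψ
  | _ + 1, ψ => allsFrom k ψ.all

/-- The `∃^k∀*` sentence `∃x₁…∃x_k ∀y₁…∀y_n ψ` built from a quantifier-free matrix `ψ`. -/
def existsForallSentence (k n : ℕ) (ψ : L.BoundedFormula Empty (k + n)) : L.Sentence :=
  (allsFrom k ψ).exs

/-- A sentence `φ` is `k`-hereditary modulo a theory `V` if every (nonempty) model `M` of
`V ∪ {φ}` has a `k`-crux: a set `C` of at most `k` elements of `M` such that every (nonempty)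
substructure of `M` that contains `C` and satisfies `V` also satisfies `φ`. -/
def KHereditary (V : L.Theory) (k : ℕ) (φ : L.Sentence) : Prop :=
  ∀ (M : Type w) [L.Structure M] [Nonempty M], M ⊨ V → M ⊨ φ →
    ∃ C : Finset M, C.card ≤ k ∧
      ∀ N : L.Substructure M, (N : Set M).Nonempty → (C : Set M) ⊆ (N : Set M) →
        (N : Type w) ⊨ V → (N : Type w) ⊨ φ

section Helpers

open Filter

theorem realize_allsFrom {M : Type w} [L.Structure M] (k : ℕ) {n : ℕ}
    (ψ : L.BoundedFormula Empty (k + n)) (v : Empty → M) (xs : Fin k → M) :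
    (allsFrom k ψ).Realize v xs ↔ ∀ ys : Fin n → M, ψ.Realize v (Fin.append xs ys) := by
  induction n with
  | zero =>
    have h : ∀ ys : Fin 0 → M, Fin.append xs ys = xs := by
      intro ys
      have : ys = Fin.elim0 := Subsingleton.elim _ _
      subst this
      rw [Fin.append_elim0]; rfl
    simp only [allsFrom, h]
    exact ⟨fun h _ => h, fun h => h Fin.elim0⟩
  | succ n ih =>
    rw [allsFrom, ih ψ.all]
    simp only [BoundedFormula.realize_all]
    constructor
    · intro h ys
      have h1 := h (Fin.init ys) (ys (Fin.last n))
      rw [← Fin.append_snoc, Fin.snoc_init_self] at h1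
      exact h1
    · intro h ys y
      have h1 := h (Fin.snoc ys y)
      rw [Fin.append_snoc] at h1
      exact h1

theorem realize_existsForall {M : Type w} [L.Structure M] (k n : ℕ)
    (ψ : L.BoundedFormula Empty (k + n)) :
    M ⊨ existsForallSentence k n ψ ↔
      ∃ a : Fin k → M, ∀ ys : Fin n → M, ψ.Realize default (Fin.append a ys) := by
  unfold existsForallSentence Sentence.Realize
  rw [BoundedFormula.realize_exs]
  simp only [realize_allsFrom]

/-- Satisfaction of the universal closure (over the variables in `ℕ`). -/
def AllR {k : ℕ} (M : Type w) [L.Structure M] (a : Fin k → M) (δ : L.Formula (Fin k ⊕ ℕ)) : Prop :=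
  ∀ y : ℕ → M, δ.Realize (Sum.elim a y)

theorem realize_congr_free {α : Type*} [DecidableEq α] {M : Type w} [L.Structure M]
    (δ : L.Formula α) (v v' : α → M) (h : ∀ x ∈ BoundedFormula.freeVarFinset δ, v x = v' x) :
    δ.Realize v ↔ δ.Realize v' := by
  unfold Formula.Realize
  rw [← BoundedFormula.realize_restrictFreeVar (f := id) (v := fun x => v x.1) v (fun _ => rfl),
    ← BoundedFormula.realize_restrictFreeVar (f := id) (v := fun x => v x.1) v'
      (fun x => h x.1 x.2)]

theorem exists_bounded (k : ℕ) (δ : L.Formula (Fin k ⊕ ℕ)) (hδ : BoundedFormula.IsQF δ) :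
    ∃ (n : ℕ) (ψ : L.BoundedFormula Empty (k + n)), ψ.IsQF ∧
      ∀ (M : Type w) [L.Structure M],
        (M ⊨ existsForallSentence k n ψ ↔ ∃ a : Fin k → M, AllR M a δ) := by
  classical
  obtain ⟨n, hn⟩ : ∃ n : ℕ, ∀ m : ℕ, Sum.inr m ∈ BoundedFormula.freeVarFinset δ → m < n + 1 := by
    refine ⟨(BoundedFormula.freeVarFinset δ).sup (Sum.elim (fun _ => 0) id), fun m hm => ?_⟩
    have := Finset.le_sup (f := Sum.elim (fun _ => 0) id) hm
    simp only [Sum.elim_inr, id] at this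
    omega
  let g : Fin k ⊕ ℕ → Empty ⊕ Fin (k + (n + 1)) :=
    Sum.elim (fun i => Sum.inr (Fin.castAdd _ i))
      (fun m => Sum.inr (Fin.natAdd k (if h : m < n + 1 then ⟨m, h⟩ else 0)))
  refine ⟨n + 1, BoundedFormula.relabel g δ, hδ.relabel g, ?_⟩
  intro M _
  rw [realize_existsForall]
  refine exists_congr fun a => ?_
  have key : ∀ ys : Fin (n + 1) → M,
      BoundedFormula.Realize (L := L) (M := M) (l := k + (n + 1)) (BoundedFormula.relabel g δ)
        default (Fin.append a ys) ↔
      δ.Realize (Sum.elim a (fun m => ys (if h : m < n + 1 then ⟨m, h⟩ else 0))) := by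
    intro ys
    obtain ⟨xs, hxs⟩ : ∃ xs : Fin (k + (n + 1)) → M, xs = Fin.append a ys := ⟨_, rfl⟩
    rw [← hxs]
    refine (BoundedFormula.realize_relabel (n := 0) (m := k + (n + 1)) (φ := δ) (g := g)
      (v := default) (xs := xs)).trans ?_
    unfold Formula.Realize
    have e1 : (Sum.elim (default : Empty → M) (xs ∘ Fin.castAdd 0) ∘ g) =
        Sum.elim a (fun m => ys (if h : m < n + 1 then ⟨m, h⟩ else 0)) := by
      funext x
      subst hxs
      rcases x with i | m
      · simp [g]
      · simp [g]
    rw [e1]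
    exact iff_of_eq (congrArg _ (Subsingleton.elim _ _))
  simp only [key]
  constructor
  · intro h y
    refine (realize_congr_free δ _ _ ?_).1 (h (fun i => y i))
    rintro (i | m) hx
    · rfl
    · simp [Nat.lt_succ_iff.1 (hn m hx)]
  · intro h ys
    exact h _

theorem sat_lemma {X : ℕ → Type w} [∀ i, Nonempty (X i)] (P : ℕ → ∀ i, X i → Prop)
    (hP : ∀ J J' i x, J ≤ J' → P J' i x → P J i x)
    (h : ∀ J, ∀ᶠ i in (hyperfilter ℕ : Filter ℕ), ∃ x, P J i x) :
    ∃ x : ∀ i, X i, ∀ J, ∀ᶠ i in (hyperfilter ℕ : Filter ℕ), P J i (x i) := by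
  classical
  have : ∀ i, ∃ x : X i, ∀ J ≤ i, (∃ x, P J i x) → P J i x := by
    intro i
    by_cases h0 : ∃ J ≤ i, ∃ x, P J i x
    · obtain ⟨J0, hJ0, h1⟩ := h0
      have h2 := Nat.findGreatest_spec (P := fun J => ∃ x, P J i x) hJ0 h1
      obtain ⟨x, hx⟩ := h2
      exact ⟨x, fun J hJ hJ' => hP _ _ _ _ (Nat.le_findGreatest hJ hJ') hx⟩
    · push Not at h0
      exact ⟨Classical.arbitrary _, fun J hJ ⟨x, hx⟩ => absurd hx (h0 J hJ x)⟩
  choose x hx using this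
  refine ⟨x, fun J => ?_⟩
  have h2 : ∀ᶠ i in (hyperfilter ℕ : Filter ℕ), J ≤ i :=
    Nat.hyperfilter_le_atTop (eventually_ge_atTop J)
  filter_upwards [h J, h2] with i h1 h2
  exact hx i J h2 h1

/-- Finite conjunctions. -/
def conj {α : Type*} (s : ℕ → L.Formula α) : ℕ → L.Formula α
  | 0 => s 0
  | J + 1 => conj s J ⊓ s (J + 1)

theorem conj_isQF {α : Type*} (s : ℕ → L.Formula α) (h : ∀ j, BoundedFormula.IsQF (s j)) (J : ℕ) :
    BoundedFormula.IsQF (conj s J) := by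
  induction J with
  | zero => exact h 0
  | succ J ih => exact ih.inf (h _)

theorem realize_conj {α : Type*} {M : Type w} [L.Structure M] (s : ℕ → L.Formula α) (J : ℕ)
    (v : α → M) : (conj s J).Realize v ↔ ∀ j ≤ J, (s j).Realize v := by
  induction J with
  | zero => simp [conj]
  | succ J ih =>
    rw [conj, Formula.realize_inf, ih]
    constructor
    · rintro ⟨h1, h2⟩ j hj
      rcases Nat.le_succ_iff.1 hj with h | h
      · exact h1 j h
      · exact h ▸ h2
    · exact fun h => ⟨fun j hj => h j (by omega), h _ le_rfl⟩

/-- Disjunction of universal formulas, with the universal variables made disjoint. -/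
def or2 {k : ℕ} (δ ε : L.Formula (Fin k ⊕ ℕ)) : L.Formula (Fin k ⊕ ℕ) :=
  (δ.relabel (Sum.map id (fun m => 2 * m)) : L.Formula (Fin k ⊕ ℕ)) ⊔
    (ε.relabel (Sum.map id (fun m => 2 * m + 1)) : L.Formula (Fin k ⊕ ℕ))

theorem or2_isQF {k : ℕ} {δ ε : L.Formula (Fin k ⊕ ℕ)} (h1 : BoundedFormula.IsQF δ)
    (h2 : BoundedFormula.IsQF ε) : BoundedFormula.IsQF (or2 δ ε) :=
  BoundedFormula.IsQF.sup (h1.relabel _) (h2.relabel _)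

theorem allR_or2 {k : ℕ} {M : Type w} [L.Structure M] (a : Fin k → M)
    (δ ε : L.Formula (Fin k ⊕ ℕ)) : AllR M a (or2 δ ε) ↔ AllR M a δ ∨ AllR M a ε := by
  unfold AllR or2
  simp only [Formula.realize_sup, Formula.realize_relabel, Sum.elim_comp_map, Function.comp_id]
  constructor
  · intro h
    by_contra hc
    push Not at hc
    obtain ⟨⟨y, hy⟩, z, hz⟩ := hc
    rcases h (fun m => if m % 2 = 0 then y (m / 2) else z (m / 2)) with h | h
    · apply hy
      convert h using 2
      funext m
      simp
    · apply hz
      convert h using 2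
      funext m
      simp [Nat.add_mod, show (2 * m + 1) / 2 = m by omega]
  · rintro (h | h) y
    · exact Or.inl (h _)
    · exact Or.inr (h _)

/-- Finite disjunctions. -/
def disj {k : ℕ} (s : ℕ → L.Formula (Fin k ⊕ ℕ)) : ℕ → L.Formula (Fin k ⊕ ℕ)
  | 0 => s 0
  | J + 1 => or2 (disj s J) (s (J + 1))

theorem disj_isQF {k : ℕ} (s : ℕ → L.Formula (Fin k ⊕ ℕ))
    (h : ∀ j, BoundedFormula.IsQF (s j)) (J : ℕ) : BoundedFormula.IsQF (disj s J) := by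
  induction J with
  | zero => exact h 0
  | succ J ih => exact or2_isQF ih (h _)

theorem allR_disj {k : ℕ} {M : Type w} [L.Structure M] (a : Fin k → M)
    (s : ℕ → L.Formula (Fin k ⊕ ℕ)) (J : ℕ) :
    AllR M a (disj s J) ↔ ∃ j ≤ J, AllR M a (s j) := by
  induction J with
  | zero => simp [disj]
  | succ J ih =>
    rw [disj, allR_or2, ih]
    constructor
    · rintro (⟨j, hj, h⟩ | h)
      · exact ⟨j, by omega, h⟩
      · exact ⟨_, le_rfl, h⟩
    · rintro ⟨j, hj, h⟩
      rcases Nat.le_succ_iff.1 hj with h' | h'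
      · exact Or.inl ⟨j, h', h⟩
      · subst h'; exact Or.inr h

theorem exists_countable_elementary [Countable L.Symbols] (N : Type w) [L.Structure N]
    (s : Set N) (hs : s.Countable) :
    ∃ S : L.ElementarySubstructure N, s ⊆ S ∧ Countable S := by
  by_cases hN : Countable N
  · exact ⟨⊤, fun x _ => trivial, Subtype.countable⟩
  · have hc : Cardinal.aleph0 ≤ Cardinal.mk N := by
      rw [← not_lt]
      intro h
      exact hN (Cardinal.mk_le_aleph0_iff.1 h.le)
    have hL : L.card ≤ Cardinal.aleph0 := Cardinal.mk_le_aleph0_iff.2 inferInstance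
    obtain ⟨S, h1, h2⟩ := exists_elementarySubstructure_card_eq L s (Cardinal.aleph0.{0}) le_rfl
      (by simpa using hs) (by simpa using hL) (by simpa using hc)
    refine ⟨S, h1, ?_⟩
    rw [← Cardinal.mk_le_aleph0_iff]
    simp only [Cardinal.lift_aleph0, Cardinal.lift_uzero] at h2
    exact h2.le

/-- A map preserving all quantifier-free formulas yields an embedding. -/
theorem exists_embedding {k : ℕ} {N : Type w} {M : Type w} [L.Structure N] [L.Structure M]
    (b : Fin k → N) (a : Fin k → M) (e : ℕ → N) (he : Function.Surjective e) (z : ℕ → M)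
    (h : ∀ δ : L.Formula (Fin k ⊕ ℕ), BoundedFormula.IsQF δ →
      δ.Realize (Sum.elim b e) → δ.Realize (Sum.elim a z)) :
    ∃ f : N ↪[L] M, ∀ i, f (b i) = a i := by
  have h' : ∀ δ : L.Formula (Fin k ⊕ ℕ), BoundedFormula.IsQF δ →
      (δ.Realize (Sum.elim b e) ↔ δ.Realize (Sum.elim a z)) := by
    intro δ hδ
    refine ⟨h δ hδ, fun h1 => ?_⟩
    by_contra h2
    have := h δ.not hδ.not (by rwa [Formula.realize_not])
    rw [Formula.realize_not] at this
    exact this h1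
  have heq : ∀ t t' : L.Term (Fin k ⊕ ℕ),
      t.realize (Sum.elim b e) = t'.realize (Sum.elim b e) ↔
      t.realize (Sum.elim a z) = t'.realize (Sum.elim a z) := by
    intro t t'
    have := h' (t.equal t') (BoundedFormula.IsAtomic.equal _ _).isQF
    rwa [Formula.realize_equal, Formula.realize_equal] at this
  obtain ⟨r, hr⟩ := he.hasRightInverse
  have hz : ∀ m m', e m = e m' ↔ z m = z m' := fun m m' =>
    heq (Term.var (Sum.inr m)) (Term.var (Sum.inr m'))
  refine ⟨⟨⟨fun n => z (r n), ?_⟩, ?_, ?_⟩, ?_⟩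
  · intro x y hxy
    have := (hz _ _).2 hxy
    rwa [hr, hr] at this
  · intro n f x
    have := (heq (Term.var (Sum.inr (r (Structure.funMap f x))))
      (Term.func f (fun i => Term.var (Sum.inr (r (x i)))))).1 (by
        simp [hr _])
    simpa [Function.comp_def] using this
  · intro n R x
    have := h' (R.formula (fun i => Term.var (Sum.inr (r (x i)))))
      (BoundedFormula.IsAtomic.rel _ _).isQF
    rw [Formula.realize_rel, Formula.realize_rel] at this
    simp only [Term.realize_var, Sum.elim_inr, hr _] at this
    exact this.symm
  · intro i
    have := (heq (Term.var (Sum.inr (r (b i)))) (Term.var (Sum.inl i))).1 (by simp [hr _])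
    exact this

theorem isQF_countable_range [Countable L.Symbols] {k : ℕ} (S : Set (L.Formula (Fin k ⊕ ℕ)))
    (hS : S.Nonempty) : ∃ s : ℕ → L.Formula (Fin k ⊕ ℕ), S = Set.range s :=
  (Set.to_countable S).exists_eq_range hS

theorem ultra_model {M : ℕ → Type w} [∀ i, L.Structure (M i)] [∀ i, Nonempty (M i)]
    (V : L.Theory) (h : ∀ i, M i ⊨ V) :
    ((hyperfilter ℕ : Ultrafilter ℕ) : Filter ℕ).Product M ⊨ V := by
  rw [Theory.model_iff]
  intro σ hσ
  rw [Ultraproduct.sentence_realize]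
  exact Eventually.of_forall fun i => (Theory.model_iff V).1 (h i) σ hσ

theorem exists_lift {M : ℕ → Type w} {β : Type*}
    (a : β → ((hyperfilter ℕ : Ultrafilter ℕ) : Filter ℕ).Product M) :
    ∃ x : β → ∀ i, M i,
      a = fun j => ((x j : ∀ i, M i) : ((hyperfilter ℕ : Ultrafilter ℕ) : Filter ℕ).Product M) := by
  choose x hx using fun j => Quotient.exists_rep (a j)
  exact ⟨x, funext fun j => (hx j).symm⟩

theorem coe_elim {M : ℕ → Type w} {k : ℕ} (x : Fin k → ∀ i, M i) (y : ℕ → ∀ i, M i) :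
    (Sum.elim (fun j => ((x j : ∀ i, M i) : ((hyperfilter ℕ : Ultrafilter ℕ) : Filter ℕ).Product M))
      (fun j => ((y j : ∀ i, M i) : ((hyperfilter ℕ : Ultrafilter ℕ) : Filter ℕ).Product M))) =
    fun j => ((Sum.elim x y j : ∀ i, M i) :
      ((hyperfilter ℕ : Ultrafilter ℕ) : Filter ℕ).Product M) := by
  funext j; cases j <;> rfl

theorem realize_elim_cast {M : ℕ → Type w} [∀ i, L.Structure (M i)] [∀ i, Nonempty (M i)]
    {k : ℕ} (x : Fin k → ∀ i, M i) (y : ℕ → ∀ i, M i) (δ : L.Formula (Fin k ⊕ ℕ)) :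
    δ.Realize (Sum.elim
      (fun j => ((x j : ∀ i, M i) : ((hyperfilter ℕ : Ultrafilter ℕ) : Filter ℕ).Product M))
      (fun j => ((y j : ∀ i, M i) : ((hyperfilter ℕ : Ultrafilter ℕ) : Filter ℕ).Product M))) ↔
    ∀ᶠ i in (hyperfilter ℕ : Filter ℕ),
      δ.Realize (Sum.elim (fun j => x j i) (fun j => y j i)) := by
  rw [coe_elim, Ultraproduct.realize_formula_cast]
  have : ∀ i, (fun j => Sum.elim x y j i) = Sum.elim (fun j => x j i) (fun j => y j i) := by
    intro i; funext j; cases j <;> rfl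
  simp only [this]

/-- If universal formulas hold at eventually every coordinate, they hold in the ultraproduct,
and conversely. -/
theorem allR_cast {M : ℕ → Type w} [∀ i, L.Structure (M i)] [∀ i, Nonempty (M i)]
    {k : ℕ} (x : Fin k → ∀ i, M i) (δ : L.Formula (Fin k ⊕ ℕ)) :
    AllR (((hyperfilter ℕ : Ultrafilter ℕ) : Filter ℕ).Product M)
      (fun j => ((x j : ∀ i, M i) : ((hyperfilter ℕ : Ultrafilter ℕ) : Filter ℕ).Product M)) δ ↔
    ∀ᶠ i in (hyperfilter ℕ : Filter ℕ), AllR (M i) (fun j => x j i) δ := by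
  constructor
  · intro h
    have : ∀ i, ∃ y : ℕ → M i, δ.Realize (Sum.elim (fun j => x j i) y) →
        AllR (M i) (fun j => x j i) δ := by
      intro i
      by_cases hc : AllR (M i) (fun j => x j i) δ
      · exact ⟨Classical.arbitrary _, fun _ => hc⟩
      · unfold AllR at hc
        push Not at hc
        obtain ⟨y, hy⟩ := hc
        exact ⟨y, fun h => absurd h hy⟩
    choose y hy using this
    have h1 := (realize_elim_cast x (fun m i => y i m) δ).1 (h _)
    filter_upwards [h1] with i hi
    exact hy i hi
  · intro h z
    obtain ⟨y, rfl⟩ := exists_lift z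
    refine (realize_elim_cast x y δ).2 ?_
    filter_upwards [h] with i hi
    exact hi _

theorem transfer_range {k : ℕ} {P M : Type w} [L.Structure P] [L.Structure M] [hP : Nonempty P]
    (V : L.Theory) (φ : L.Sentence) (b : Fin k → P) (a : Fin k → M) (C : Finset M)
    (haC : (C : Set M) ⊆ Set.range a)
    (hC : ∀ N : L.Substructure M, (N : Set M).Nonempty → (C : Set M) ⊆ (N : Set M) →
        (N : Type w) ⊨ V → (N : Type w) ⊨ φ)
    (f : P ↪[L] M) (hf : ∀ i, f (b i) = a i) (hPV : P ⊨ V) : P ⊨ φ := by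
  have hfin := hC f.toHom.range ⟨f hP.some, f.toHom.mem_range_self _⟩ (by
    intro c hc
    obtain ⟨j, rfl⟩ := haC hc
    exact ⟨b j, hf j⟩) (by
      have := hPV
      exact StrongHomClass.theory_model f.equivRange)
  exact (StrongHomClass.realize_sentence f.equivRange φ).2 hfin

theorem forward [Countable L.Symbols] (V : L.Theory) (φ : L.Sentence) (k : ℕ)
    (hH : KHereditary.{u, v, w} V k φ) :
    ∃ δ : L.Formula (Fin k ⊕ ℕ), BoundedFormula.IsQF δ ∧
      ∀ (M : Type w) [L.Structure M] [Nonempty M], M ⊨ V →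
        (M ⊨ φ ↔ ∃ a : Fin k → M, AllR M a δ) := by
  classical
  by_contra hcon
  -- the good formulas
  let S : Set (L.Formula (Fin k ⊕ ℕ)) := {δ | BoundedFormula.IsQF δ ∧
    ∀ (M : Type w) [L.Structure M] [Nonempty M], M ⊨ V → (∃ a : Fin k → M, AllR M a δ) → M ⊨ φ}
  have hS : S.Nonempty := by
    refine ⟨⊥, BoundedFormula.isQF_bot, ?_⟩
    rintro M _ _ - ⟨a, ha⟩
    exact (ha (Classical.arbitrary _)).elim
  obtain ⟨s, hs⟩ := isQF_countable_range S hS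
  have hsS : ∀ j, s j ∈ S := fun j => hs ▸ Set.mem_range_self j
  have step1 : ∀ J, ∃ (M : Type w) (_ : L.Structure M) (_ : Nonempty M), M ⊨ V ∧ M ⊨ φ ∧
      ∀ j ≤ J, ¬ ∃ a : Fin k → M, AllR M a (s j) := by
    intro J
    by_contra hJ
    apply hcon
    refine ⟨disj s J, disj_isQF s (fun j => (hsS j).1) J, ?_⟩
    intro M _ _ hV
    constructor
    · intro hφ
      by_contra hc
      apply hJ
      refine ⟨M, inferInstance, inferInstance, hV, hφ, ?_⟩
      rintro j hj ⟨a, ha⟩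
      exact hc ⟨a, (allR_disj a s J).2 ⟨j, hj, ha⟩⟩
    · rintro ⟨a, ha⟩
      obtain ⟨j, hj, h⟩ := (allR_disj a s J).1 ha
      exact (hsS j).2 M hV ⟨a, h⟩
  choose M iM nM hMV hMφ hMs using step1
  let MM := ((hyperfilter ℕ : Ultrafilter ℕ) : Filter ℕ).Product M
  have hMMV : MM ⊨ V := ultra_model V hMV
  have hMMφ : MM ⊨ φ := by
    rw [Ultraproduct.sentence_realize]
    exact Eventually.of_forall hMφ
  obtain ⟨C, hCk, hC⟩ := hH MM hMMV hMMφ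
  -- enumerate the crux
  obtain ⟨a, haC⟩ : ∃ a : Fin k → MM, (C : Set MM) ⊆ Set.range a := by
    let c := C.equivFin
    refine ⟨fun i => if h : i.1 < C.card then (c.symm ⟨i, h⟩).1 else Classical.arbitrary _, ?_⟩
    intro x hx
    refine ⟨⟨(c ⟨x, hx⟩).1, lt_of_lt_of_le (c ⟨x, hx⟩).2 hCk⟩, ?_⟩
    simp
  obtain ⟨x, rfl⟩ := exists_lift a
  set a : Fin k → MM := fun j => ((x j : ∀ i, M i) : MM) with ha
  -- the universal type of the crux
  let T : Set (L.Formula (Fin k ⊕ ℕ)) := {δ | BoundedFormula.IsQF δ ∧ AllR MM a δ}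
  have hT : T.Nonempty := ⟨⊤, BoundedFormula.IsQF.top, fun y => Formula.realize_top.2 trivial⟩
  obtain ⟨t, ht⟩ := isQF_countable_range T hT
  have htT : ∀ j, t j ∈ T := fun j => ht ▸ Set.mem_range_self j
  have step2 : ∀ J, ∃ (N : Type w) (_ : L.Structure N) (_ : Nonempty N) (b : Fin k → N),
      N ⊨ V ∧ ¬ N ⊨ φ ∧ ∀ j ≤ J, AllR N b (t j) := by
    intro J
    by_contra hJ
    have hmem : conj t J ∈ S := by
      refine ⟨conj_isQF t (fun j => (htT j).1) J, ?_⟩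
      rintro N _ _ hV ⟨b, hb⟩
      by_contra hφ
      exact hJ ⟨N, inferInstance, inferInstance, b, hV, hφ, fun j hj y =>
        (realize_conj t J _).1 (hb y) j hj⟩
    rw [hs] at hmem
    obtain ⟨j, hj⟩ := hmem
    have h1 : AllR MM a (s j) := by
      rw [hj]
      exact fun y => (realize_conj t J _).2 fun j _ => (htT j).2 y
    rw [ha, allR_cast] at h1
    have h2 : ∀ᶠ i in (hyperfilter ℕ : Filter ℕ), j ≤ i :=
      Nat.hyperfilter_le_atTop (eventually_ge_atTop j)
    obtain ⟨i, hi1, hi2⟩ := (h1.and h2).exists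
    exact hMs i j hi2 ⟨_, hi1⟩
  choose N iN nN b0 hNV hNφ hNt using step2
  let NN := ((hyperfilter ℕ : Ultrafilter ℕ) : Filter ℕ).Product N
  have hNNV : NN ⊨ V := ultra_model V hNV
  have hNNφ : ¬ NN ⊨ φ := by
    rw [Ultraproduct.sentence_realize]
    intro h
    obtain ⟨i, hi⟩ := h.exists
    exact hNφ i hi
  let b : Fin k → NN := fun j => (((fun i => b0 i j) : ∀ i, N i) : NN)
  have hNNt : ∀ j, AllR NN b (t j) := by
    intro j
    refine (allR_cast (fun j i => b0 i j) (t j)).2 ?_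
    have h2 : ∀ᶠ i in (hyperfilter ℕ : Filter ℕ), j ≤ i :=
      Nat.hyperfilter_le_atTop (eventually_ge_atTop j)
    filter_upwards [h2] with i hi
    exact hNt i j hi
  -- countable elementary substructure (containing some element)
  obtain ⟨P, hbP, hPc⟩ := exists_countable_elementary (L := L) NN
    (Set.range b ∪ {Classical.arbitrary NN}) ((Set.countable_range b).union (Set.countable_singleton _))
  have hPn : Nonempty P := ⟨⟨Classical.arbitrary NN, hbP (Or.inr rfl)⟩⟩
  let b' : Fin k → P := fun j => ⟨b j, hbP (Or.inl ⟨j, rfl⟩)⟩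
  have hPV : P ⊨ V := (P.theory_model_iff V).2 hNNV
  have hPφ : ¬ P ⊨ φ := fun h => hNNφ ((P.realize_sentence φ).1 h)
  have hPt : ∀ δ : L.Formula (Fin k ⊕ ℕ), BoundedFormula.IsQF δ → AllR MM a δ → AllR P b' δ := by
    intro δ h1 h2 y
    have : δ ∈ T := ⟨h1, h2⟩
    rw [ht] at this
    obtain ⟨j, rfl⟩ := this
    have h3 := hNNt j (fun m => (y m : NN))
    have h4 := P.subtype.map_formula (t j) (Sum.elim b' y)
    rw [← h4]
    convert h3 using 1
    funext q
    cases q <;> rfl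
  obtain ⟨e, he⟩ := exists_surjective_nat P
  -- the diagram
  let D : Set (L.Formula (Fin k ⊕ ℕ)) :=
    {δ | BoundedFormula.IsQF δ ∧ δ.Realize (Sum.elim b' e)}
  have hD : D.Nonempty := ⟨⊤, BoundedFormula.IsQF.top, Formula.realize_top.2 trivial⟩
  obtain ⟨d, hd⟩ := isQF_countable_range D hD
  have hdD : ∀ j, d j ∈ D := fun j => hd ▸ Set.mem_range_self j
  have hsat := sat_lemma (X := fun i => ℕ → M i)
    (fun J i y => (conj d J).Realize (Sum.elim (fun j => x j i) y)) (by
      intro J J' i y hJ h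
      rw [realize_conj] at h ⊢
      exact fun j hj => h j (hj.trans hJ)) (by
      intro J
      have h1 : ¬ AllR MM a (conj d J).not := by
        intro h
        have h2 := hPt _ (conj_isQF d (fun j => (hdD j).1) J).not h e
        rw [Formula.realize_not, realize_conj] at h2
        exact h2 fun j _ => (hdD j).2
      rw [ha, allR_cast, ← Ultrafilter.eventually_not] at h1
      filter_upwards [h1] with i hi
      unfold AllR at hi
      push Not at hi
      obtain ⟨y, hy⟩ := hi
      rw [Formula.realize_not, not_not] at hy
      exact ⟨y, hy⟩)
  obtain ⟨y, hy⟩ := hsat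
  obtain ⟨f, hf⟩ := exists_embedding b' a e he
    (fun m => (((fun i => y i m) : ∀ i, M i) : MM)) (by
      intro δ h1 h2
      have : δ ∈ D := ⟨h1, h2⟩
      rw [hd] at this
      obtain ⟨j, rfl⟩ := this
      refine (realize_elim_cast x (fun m i => y i m) (d j)).2 ?_
      filter_upwards [hy j] with i hi
      exact (realize_conj d j _).1 hi j le_rfl)
  exact hPφ (transfer_range V φ b' a C haC hC f hf hPV)

theorem backward (V : L.Theory) (φ : L.Sentence) (k n : ℕ)
    (ψ : L.BoundedFormula Empty (k + n)) (hψ : ψ.IsQF)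
    (h : ∀ (M : Type w) [L.Structure M] [Nonempty M], M ⊨ V →
          (M ⊨ φ ↔ M ⊨ existsForallSentence k n ψ)) :
    KHereditary.{u, v, w} V k φ := by
  classical
  intro M _ _ hV hφ
  obtain ⟨a, ha⟩ := (realize_existsForall k n ψ).1 ((h M hV).1 hφ)
  refine ⟨Finset.univ.image a, Finset.card_image_le.trans (by simp), ?_⟩
  intro N hne hC hNV
  have hN : Nonempty N := hne.to_subtype
  have haN : ∀ i, a i ∈ N := fun i => hC (by simp)
  refine (h N hNV).2 ((realize_existsForall k n ψ).2 ⟨fun i => ⟨a i, haN i⟩, fun ys => ?_⟩)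
  have h1 := ha (fun i => (ys i : M))
  have h2 := hψ.realize_embedding N.subtype (v := default)
    (xs := Fin.append (fun i => (⟨a i, haN i⟩ : N)) ys)
  refine h2.1 ?_
  convert h1 using 1
  funext i
  refine Fin.addCases (fun i => ?_) (fun i => ?_) i <;> simp

end Helpers

/-- **Generalized Łoś–Tarski theorem `GLT(k)`, hereditary direction** (for sentences):
over arbitrary structures, a sentence `φ` is `k`-hereditary modulo a theory `V` iff it is
equivalent modulo `V` to an `∃^k∀*` sentence `∃x₁…∃x_k ∀y₁…∀y_n ψ` with `ψ` quantifier-free. -/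
theorem glt_k_hereditary (hfin : Finite L.Symbols) (V : L.Theory) (φ : L.Sentence) (k : ℕ) :
    KHereditary.{u, v, w} V k φ ↔
      ∃ (n : ℕ) (ψ : L.BoundedFormula Empty (k + n)), ψ.IsQF ∧
        ∀ (M : Type w) [L.Structure M] [Nonempty M], M ⊨ V →
          (M ⊨ φ ↔ M ⊨ existsForallSentence k n ψ) := by

  have : Countable L.Symbols := Finite.to_countable
  constructor
  · intro hH
    obtain ⟨δ, h1, h2⟩ := forward V φ k hH
    obtain ⟨n, ψ, h3, h4⟩ := exists_bounded.{u, v, w} k δ h1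
    exact ⟨n, ψ, h3, fun M _ _ hV => (h2 M hV).trans (h4 M).symm⟩
  · rintro ⟨n, ψ, h1, h2⟩
    exact backward V φ k n ψ h1 h2

end GLTPaper
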